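/- Let b be a nonnegative even integer and let k and m be positive integers with m ≥ 5. Then, modulo 2^{m+5}: E_{2^m k + b} ≡ E_b - 11·2^m k if b ≡ 0 or 14 (mod 16); E_{2^m k + b} ≡ E_b + 13·2^m k if b ≡ 2 or 12 (mod 16); E_{2^m k + b} ≡ E_b - 3·2^m k if b ≡ 4 or 10 (mod 16); and E_{2^m k + b} ≡ E_b + 5·2^m k if b ≡ 6 or 8 (mod 16). -/

import Mathlib

/-- The Euler numbers `E n`, defined by `E 0 = 1`, `E (2n-1) = 0` for `n ≥ 1`,
and `∑_{r=0}^{n} C(2n, 2r) * E (2r) = 0` for `n ≥ 1`. -/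
def eulerE : ℕ → ℤ
  | 0 => 1
  | 1 => 0
  | n + 2 =>
      if Even n then
        -∑ r ∈ (Finset.range (n / 2 + 1)).attach,
          ((n + 2).choose (2 * r.1) : ℤ) * eulerE (2 * r.1)
      else 0
  decreasing_by
    have := r.2
    simp only [Finset.mem_range] at this
    omega

open Polynomial in
/-- The umbral functional: the linear map `ℤ[X] → ℤ` sending `X ^ n` to `eulerE n`. -/
noncomputable def eulerFunctional : ℤ[X] →ₗ[ℤ] ℤ :=
  (Polynomial.basisMonomials ℤ).constr ℤ eulerE

namespace eulerFunctional

open Polynomial Finset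

theorem apply_X_pow (n : ℕ) : eulerFunctional (X ^ n) = eulerE n := by
  have h := (Polynomial.basisMonomials ℤ).constr_basis ℤ eulerE n
  simpa [eulerFunctional, Polynomial.coe_basisMonomials, Polynomial.monomial_one_right_eq_X_pow]
    using h

theorem apply_C_mul (c : ℤ) (f : ℤ[X]) : eulerFunctional (C c * f) = c * eulerFunctional f := by
  rw [← smul_eq_C_mul, map_smul, smul_eq_mul]

theorem _root_.eulerE_odd (n : ℕ) : eulerE (2 * n + 1) = 0 := by
  cases n with
  | zero => simp [eulerE]
  | succ n =>
    rw [show 2 * (n + 1) + 1 = (2 * n + 1) + 2 by ring, eulerE]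
    simp

theorem _root_.sum_choose_mul_eulerE (n : ℕ) :
    ∑ r ∈ range (n + 2), ((2 * n + 2).choose (2 * r) : ℤ) * eulerE (2 * r) = 0 := by
  rw [sum_range_succ, show 2 * (n + 1) = 2 * n + 2 by ring, eulerE]
  simp only [even_two, Even.mul_right, if_true]
  rw [sum_attach (range (2 * n / 2 + 1))
    (fun r => ((2 * n + 2).choose (2 * r) : ℤ) * eulerE (2 * r))]
  simp

theorem _root_.Finset.sum_range_two_mul_add_one_of_odd_eq_zero (g : ℕ → ℤ)
    (hg : ∀ r, g (2 * r + 1) = 0) (N : ℕ) :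
    ∑ k ∈ range (2 * N + 1), g k = ∑ r ∈ range (N + 1), g (2 * r) := by
  induction N with
  | zero => simp
  | succ N ih =>
    rw [show 2 * (N + 1) + 1 = 2 * N + 1 + 1 + 1 by ring, sum_range_succ, sum_range_succ, ih, hg,
      sum_range_succ _ (N + 1)]
    simp [mul_add]

theorem apply_X_add_one_pow_add (n : ℕ) :
    eulerFunctional ((X + 1) ^ n) + eulerFunctional ((X - 1) ^ n) = 2 * 0 ^ n := by
  have h (c : ℤ) : eulerFunctional ((X + C c) ^ n) =
      ∑ k ∈ range (n + 1), c ^ (n - k) * (n.choose k) * eulerE k := by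
    rw [add_pow, map_sum]
    refine sum_congr rfl fun k _ => ?_
    rw [← apply_X_pow, ← apply_C_mul]
    congr 1
    simp only [map_mul, map_pow, map_natCast]
    ring
  have h1 := h 1
  have h2 := h (-1)
  simp only [map_one, map_neg, ← sub_eq_add_neg] at h1 h2
  rw [h1, h2, ← sum_add_distrib]
  obtain ⟨N, rfl | rfl⟩ := n.even_or_odd'
  · rw [sum_range_two_mul_add_one_of_odd_eq_zero _ (by simp [eulerE_odd])]
    cases N with
    | zero => simp [eulerE]
    | succ N =>
      have hs := sum_choose_mul_eulerE N
      rw [zero_pow (by omega), mul_zero, ← mul_zero 2, ← hs, mul_sum]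
      refine sum_congr rfl fun r _ => ?_
      rw [Even.neg_one_pow (by rw [← Nat.mul_sub]; exact even_two_mul _)]
      simp only [one_pow, one_mul, mul_add]
      ring
  · rw [zero_pow (by omega), mul_zero]
    refine sum_eq_zero fun k hk => ?_
    rw [mem_range] at hk
    obtain ⟨r, rfl | rfl⟩ := k.even_or_odd'
    · rw [Odd.neg_one_pow ⟨N - r, by omega⟩]
      ring
    · simp [eulerE_odd]

theorem apply_comp_add (f : ℤ[X]) :
    eulerFunctional (f.comp (X + 1)) + eulerFunctional (f.comp (X - 1)) = 2 * f.eval 0 := by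
  induction f using Polynomial.induction_on' with
  | add p q hp hq =>
    simp only [add_comp, map_add, eval_add]
    linear_combination hp + hq
  | monomial n a =>
    rw [← C_mul_X_pow_eq_monomial]
    simp only [mul_comp, C_comp, X_pow_comp, apply_C_mul, eval_mul, eval_C, eval_pow, eval_X]
    linear_combination a * apply_X_add_one_pow_add n

/-- `(X² - 1²)(X² - 3²)⋯(X² - (2i-1)²)`. -/
noncomputable def oddFactorial (i : ℕ) : ℤ[X] :=
  ∏ j ∈ range i, (X ^ 2 - (2 * (j : ℤ[X]) + 1) ^ 2)

/-- `(X² - 2²)(X² - 4²)⋯(X² - (2i)²)`. -/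
noncomputable def evenFactorial (i : ℕ) : ℤ[X] :=
  ∏ j ∈ range i, (X ^ 2 - (2 * (j : ℤ[X]) + 2) ^ 2)

theorem oddFactorial_succ (i : ℕ) :
    oddFactorial (i + 1) = oddFactorial i * (X ^ 2 - (2 * (i : ℤ[X]) + 1) ^ 2) :=
  prod_range_succ _ _

theorem evenFactorial_succ (i : ℕ) :
    evenFactorial (i + 1) = evenFactorial i * (X ^ 2 - (2 * (i : ℤ[X]) + 2) ^ 2) :=
  prod_range_succ _ _

theorem evenFactorial_comp_add_one (i : ℕ) :
    (X + 1) * (evenFactorial i).comp (X + 1) = (X + 2 * (i : ℤ[X]) + 1) * oddFactorial i := by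
  induction i with
  | zero => simp [evenFactorial, oddFactorial]
  | succ i ih =>
    rw [evenFactorial_succ, oddFactorial_succ]
    simp only [mul_comp, sub_comp, X_comp, pow_comp, add_comp, natCast_comp, ofNat_comp]
    push_cast
    linear_combination ((X + 1) ^ 2 - (2 * (i : ℤ[X]) + 2) ^ 2) * ih

theorem evenFactorial_comp_sub_one (i : ℕ) :
    (X - 1) * (evenFactorial i).comp (X - 1) = (X - 2 * (i : ℤ[X]) - 1) * oddFactorial i := by
  induction i with
  | zero => simp [evenFactorial, oddFactorial]
  | succ i ih =>
    rw [evenFactorial_succ, oddFactorial_succ]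
    simp only [mul_comp, sub_comp, X_comp, pow_comp, add_comp, natCast_comp, ofNat_comp]
    push_cast
    linear_combination ((X - 1) ^ 2 - (2 * (i : ℤ[X]) + 2) ^ 2) * ih

theorem apply_oddFactorial (i : ℕ) :
    eulerFunctional (oddFactorial i) = (-1) ^ i * ((2 * i).factorial : ℤ) := by
  induction i with
  | zero => simpa [oddFactorial, eulerE] using apply_X_pow 0
  | succ i ih =>
    have h := apply_comp_add (X ^ 2 * evenFactorial i)
    have key : (X ^ 2 * evenFactorial i).comp (X + 1) + (X ^ 2 * evenFactorial i).comp (X - 1) =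
        C 2 * oddFactorial (i + 1) + C (2 * (2 * (i : ℤ) + 1) * (2 * i + 2)) * oddFactorial i := by
      rw [oddFactorial_succ]
      simp only [mul_comp, X_pow_comp, map_mul, map_add, map_natCast, map_one, map_ofNat]
      linear_combination (X + 1) * evenFactorial_comp_add_one i +
        (X - 1) * evenFactorial_comp_sub_one i
    rw [← map_add, key, map_add, apply_C_mul, apply_C_mul, ih] at h
    simp only [eval_mul, eval_pow, eval_X] at h
    rw [show 2 * (i + 1) = 2 * i + 1 + 1 by ring, Nat.factorial_succ, Nat.factorial_succ]
    push_cast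
    refine mul_left_cancel₀ (two_ne_zero' ℤ) ?_
    linear_combination h

/-- The `i`-th forward difference at `n` of the sequence `r ↦ eulerE (2 * r)`. -/
noncomputable def diff (i n : ℕ) : ℤ :=
  eulerFunctional (X ^ (2 * n) * (X ^ 2 - 1) ^ i)

theorem diff_zero (n : ℕ) : diff 0 n = eulerE (2 * n) := by
  simp [diff, apply_X_pow]

theorem diff_succ_right (i n : ℕ) : diff i (n + 1) = diff i n + diff (i + 1) n := by
  rw [diff, diff, diff, ← map_add]
  congr 1
  ring

theorem eulerE_eq_sum_choose_mul_diff (n h : ℕ) :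
    eulerE (2 * (n + h)) = ∑ i ∈ range (h + 1), (h.choose i : ℤ) * diff i n := by
  have key : (X : ℤ[X]) ^ (2 * (n + h)) =
      ∑ i ∈ range (h + 1), C (h.choose i : ℤ) * (X ^ (2 * n) * (X ^ 2 - 1) ^ i) := by
    have e : (X : ℤ[X]) ^ (2 * (n + h)) = X ^ (2 * n) * ((X ^ 2 - 1) + 1) ^ h := by
      rw [sub_add_cancel]
      ring
    rw [e, add_pow, mul_sum]
    refine sum_congr rfl fun i _ => ?_
    simp only [map_natCast, one_pow]
    ring
  rw [← apply_X_pow, key, map_sum]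
  exact sum_congr rfl fun i _ => apply_C_mul _ _

/-- A lower bound for the 2-adic valuation of `(2 * n)!`. -/
def weight (n : ℕ) : ℕ := n + 3 * (n / 4) + n % 4 / 2

theorem two_pow_weight_dvd_factorial (n : ℕ) : 2 ^ weight n ∣ (2 * n).factorial := by
  induction n using Nat.strong_induction_on with
  | _ n ih =>
    by_cases hn : n < 4
    · interval_cases n <;> decide
    · obtain ⟨r, rfl⟩ : ∃ r, n = 4 + r := ⟨n - 4, by omega⟩
      have h1 := ih r (by omega)
      have h2 := Nat.factorial_mul_factorial_dvd_factorial_add 8 (2 * r)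
      have h3 : 2 ^ 7 ∣ Nat.factorial 8 := by decide
      rw [show weight (4 + r) = 7 + weight r by unfold weight; omega, pow_add, mul_add]
      exact (mul_dvd_mul h3 h1).trans h2

theorem two_pow_weight_dvd_apply_oddFactorial_mul (i j : ℕ) :
    (2 : ℤ) ^ weight (j + i) ∣ eulerFunctional (oddFactorial j * (X ^ 2 - 1) ^ i) := by
  induction i generalizing j with
  | zero =>
    rw [pow_zero, mul_one, apply_oddFactorial]
    exact Dvd.dvd.mul_left (mod_cast two_pow_weight_dvd_factorial j) _
  | succ i ih =>
    obtain ⟨c, hc⟩ : ∃ c, j * (j + 1) = 2 * c :=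
      (Nat.even_mul_succ_self j).two_dvd
    have key : oddFactorial j * (X ^ 2 - 1) ^ (i + 1) =
        oddFactorial (j + 1) * (X ^ 2 - 1) ^ i +
          C (8 * (c : ℤ)) * (oddFactorial j * (X ^ 2 - 1) ^ i) := by
      have hc' : (j : ℤ[X]) * (j + 1) = 2 * c := mod_cast hc
      rw [oddFactorial_succ]
      simp only [map_mul, map_natCast, map_ofNat]
      linear_combination 4 * oddFactorial j * (X ^ 2 - 1) ^ i * hc'
    rw [key, map_add, apply_C_mul]
    refine dvd_add ?_ ?_
    · rw [show j + (i + 1) = j + 1 + i by ring]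
      exact ih (j + 1)
    · have h : (2 : ℤ) ^ weight (j + (i + 1)) ∣ 2 ^ (3 + weight (j + i)) :=
        pow_dvd_pow 2 (by unfold weight; omega)
      refine h.trans ?_
      rw [pow_add]
      exact mul_dvd_mul ⟨c, by norm_num⟩ (ih j)

theorem two_pow_weight_dvd_diff (i n : ℕ) : (2 : ℤ) ^ weight i ∣ diff i n := by
  induction n generalizing i with
  | zero => simpa [diff, oddFactorial] using two_pow_weight_dvd_apply_oddFactorial_mul i 0
  | succ n ih =>
    rw [diff_succ_right]
    exact dvd_add (ih i) ((pow_dvd_pow 2 (by unfold weight; omega)).trans (ih (i + 1)))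

theorem two_pow_dvd_choose_mul_diff (q k i n : ℕ) (hi : 5 ≤ i) :
    (2 : ℤ) ^ (q + 6) ∣ ((2 ^ q * k).choose i : ℤ) * diff i n := by
  obtain ⟨v, o, ho, hvo⟩ := Nat.exists_eq_two_pow_mul_odd (n := i) (by omega)
  have hdvd : 2 ^ q ∣ (2 ^ q * k).choose i * i := by
    obtain ⟨i, rfl⟩ : ∃ r, i = r + 1 := ⟨i - 1, by omega⟩
    rcases Nat.eq_zero_or_pos (2 ^ q * k) with h0 | h0
    · simp [h0]
    · obtain ⟨h, hh⟩ : ∃ r, 2 ^ q * k = r + 1 := ⟨2 ^ q * k - 1, by omega⟩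
      have := Nat.add_one_mul_choose_eq h i
      rw [hh, ← this, ← hh, mul_assoc]
      exact dvd_mul_right _ _
  have hdvd' : 2 ^ q ∣ (2 ^ q * k).choose i * 2 ^ v := by
    have hco : Nat.Coprime (2 ^ q) o := (Nat.coprime_two_left.mpr ho).pow_left q
    refine hco.dvd_of_dvd_mul_right ?_
    rwa [mul_assoc, ← hvo]
  have hv : 6 + v ≤ weight i := by
    have h1 : 2 ^ v ≤ i := by
      rw [hvo]
      exact Nat.le_mul_of_pos_right _ ho.pos
    have h2 : v < 2 ^ v := Nat.lt_two_pow_self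
    by_cases h8 : i < 8
    · have : v < 3 := (Nat.pow_lt_pow_iff_right (a := 2) (by norm_num)).mp (by omega)
      unfold weight
      omega
    · unfold weight
      omega
  have hd : (2 : ℤ) ^ (6 + v) ∣ diff i n :=
    (pow_dvd_pow 2 hv).trans (two_pow_weight_dvd_diff i n)
  obtain ⟨a, ha⟩ := hd
  obtain ⟨c, hc⟩ := hdvd'
  have hc' : ((2 ^ q * k).choose i : ℤ) * 2 ^ v = 2 ^ q * c := mod_cast hc
  refine ⟨c * a, ?_⟩
  rw [ha, pow_add, pow_add]
  linear_combination 2 ^ 6 * a * hc'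

theorem diff_at_zero :
    diff 1 0 = -2 ∧ diff 2 0 = 8 ∧ diff 3 0 = -80 ∧ diff 4 0 = 1664 := by
  have e0 : diff 0 0 = 1 := by simp [diff_zero, eulerE]
  have h0 := sum_choose_mul_eulerE 0
  have h1 := sum_choose_mul_eulerE 1
  have h2 := sum_choose_mul_eulerE 2
  have h3 := sum_choose_mul_eulerE 3
  simp only [← diff_zero, sum_range_succ, sum_range_zero, e0] at h0 h1 h2 h3
  norm_num [Nat.choose] at h0 h1 h2 h3
  have s00 := diff_succ_right 0 0
  have s01 := diff_succ_right 0 1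
  have s02 := diff_succ_right 0 2
  have s03 := diff_succ_right 0 3
  have s10 := diff_succ_right 1 0
  have s11 := diff_succ_right 1 1
  have s12 := diff_succ_right 1 2
  have s20 := diff_succ_right 2 0
  have s21 := diff_succ_right 2 1
  have s30 := diff_succ_right 3 0
  norm_num at s00 s01 s02 s03 s10 s11 s12 s20 s21 s30
  refine ⟨?_, ?_, ?_, ?_⟩ <;> linarith

theorem diff_four (n : ℕ) : ∃ y, diff 4 n = 128 + 256 * y := by
  induction n with
  | zero => exact ⟨6, by rw [diff_at_zero.2.2.2]; norm_num⟩
  | succ n ih =>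
    obtain ⟨y, hy⟩ := ih
    obtain ⟨z, hz⟩ := two_pow_weight_dvd_diff 5 n
    rw [show weight 5 = 8 from rfl] at hz
    exact ⟨y + z, by rw [diff_succ_right, hy, hz]; ring⟩

theorem diff_three (n : ℕ) : ∃ y, diff 3 n = -80 + 128 * y := by
  induction n with
  | zero => exact ⟨0, by rw [diff_at_zero.2.2.1]; norm_num⟩
  | succ n ih =>
    obtain ⟨y, hy⟩ := ih
    obtain ⟨z, hz⟩ := diff_four n
    exact ⟨y + 1 + 2 * z, by rw [diff_succ_right, hy, hz]; ring⟩

theorem diff_two (n : ℕ) : ∃ y, diff 2 n = 8 - 80 * n + 128 * y := by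
  induction n with
  | zero => exact ⟨0, by rw [diff_at_zero.2.1]; norm_num⟩
  | succ n ih =>
    obtain ⟨y, hy⟩ := ih
    obtain ⟨z, hz⟩ := diff_three n
    exact ⟨y + z, by rw [diff_succ_right, hy, hz]; push_cast; ring⟩

theorem diff_one (n : ℕ) : ∃ y, diff 1 n = -2 + 8 * n - 8 * n * (n - 1) + 64 * y := by
  induction n with
  | zero => exact ⟨0, by rw [diff_at_zero.1]; norm_num⟩
  | succ n ih =>
    obtain ⟨y, hy⟩ := ih
    obtain ⟨z, hz⟩ := diff_two n
    exact ⟨y + 2 * z - n, by rw [diff_succ_right, hy, hz]; push_cast; ring⟩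

theorem two_pow_dvd_three_mul_eulerE_sub (q k n : ℕ) (hq : 4 ≤ q) (hk : 0 < k) :
    (2 : ℤ) ^ (q + 6) ∣ 3 * (eulerE (2 * (n + 2 ^ q * k)) - eulerE (2 * n)) -
      2 ^ q * k * (-2 + 40 * n - 24 * n ^ 2) := by
  obtain ⟨p, rfl⟩ : ∃ p, q = p + 4 := ⟨q - 4, by omega⟩
  obtain ⟨t, ht⟩ : ∃ t, 2 ^ (p + 4) * k = t + 4 :=
    ⟨2 ^ (p + 4) * k - 4, by
      have : 0 < 2 ^ p * k := by positivity
      rw [pow_add, mul_right_comm]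
      omega⟩
  have htail : (2 : ℤ) ^ (p + 4 + 6) ∣
      ∑ i ∈ range t, ((2 ^ (p + 4) * k).choose (5 + i) : ℤ) * diff (5 + i) n :=
    dvd_sum fun i _ => two_pow_dvd_choose_mul_diff _ _ _ _ (by omega)
  have hsum := eulerE_eq_sum_choose_mul_diff n (2 ^ (p + 4) * k)
  rw [show range (2 ^ (p + 4) * k + 1) = range (5 + t) by rw [ht]; congr 1; ring,
    sum_range_add] at hsum
  obtain ⟨z, hz⟩ := htail
  rw [hz] at hsum
  simp only [sum_range_succ, sum_range_zero, Nat.choose_zero_right, Nat.choose_one_right,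
    diff_zero] at hsum
  obtain ⟨y1, h1⟩ := diff_one n
  obtain ⟨y2, h2⟩ := diff_two n
  obtain ⟨y3, h3⟩ := diff_three n
  obtain ⟨y4, h4⟩ := diff_four n
  rw [h1, h2, h3, h4] at hsum
  have c2 : ((2 ^ (p + 4) * k).choose 2 : ℤ) * 2 =
      (2 ^ (p + 4) * k : ℕ) * ((2 ^ (p + 4) * k : ℕ) - 1) := by
    rw [ht]
    have := Nat.add_one_mul_choose_eq (t + 3) 1
    rw [Nat.choose_one_right] at this
    zify at this
    push_cast
    linear_combination -this
  have c3 : ((2 ^ (p + 4) * k).choose 3 : ℤ) * 3 =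
      (2 ^ (p + 4) * k).choose 2 * ((2 ^ (p + 4) * k : ℕ) - 2) := by
    rw [ht]
    have := Nat.choose_succ_right_eq (t + 4) 2
    rw [show t + 4 - 2 = t + 2 by omega] at this
    zify at this
    push_cast
    linear_combination this
  have c4 : ((2 ^ (p + 4) * k).choose 4 : ℤ) * 4 =
      (2 ^ (p + 4) * k).choose 3 * ((2 ^ (p + 4) * k : ℕ) - 3) := by
    rw [ht]
    have := Nat.choose_succ_right_eq (t + 4) 3
    rw [show t + 4 - 3 = t + 1 by omega] at this
    zify at this
    push_cast
    linear_combination this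
  rw [hsum]
  generalize ((2 ^ (p + 4) * k).choose 2 : ℤ) = b2 at *
  generalize ((2 ^ (p + 4) * k).choose 3 : ℤ) = b3 at *
  generalize ((2 ^ (p + 4) * k).choose 4 : ℤ) = b4 at *
  push_cast at *
  have hh : ((2 : ℤ) ^ (p + 4) * k) ^ 2 * 4 = 2 ^ (p + 4 + 6) * (2 ^ p * k ^ 2) := by ring
  have hw : (2 : ℤ) ^ (p + 4 + 6) = 64 * 2 ^ (p + 4) := by ring
  generalize (2 : ℤ) ^ (p + 4 + 6) = W at *
  generalize (2 : ℤ) ^ p * k ^ 2 = s at *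
  have hw' : W * k = 64 * (2 ^ (p + 4) * k) := by rw [hw]; ring
  clear hw
  generalize (2 : ℤ) ^ (p + 4) * k = h at *
  have e2 : b2 * 8 = W * s - 4 * h := by linear_combination 4 * c2 + hh
  have e3 : b3 * 48 = W * s * (2 * h - 6) + 16 * h := by
    linear_combination 16 * c3 + 8 * (h - 2) * c2 + (2 * h - 6) * hh
  have e4 : b4 * 384 = W * s * (4 * h ^ 2 - 24 * h + 44) - 96 * h := by
    linear_combination 96 * c4 + 32 * (h - 3) * c3 + 16 * (h - 2) * (h - 3) * c2 +
      (4 * h ^ 2 - 24 * h + 44) * hh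
  refine ⟨3 * z + s * (3 * (1 - 10 * n + 16 * y2) + (2 * h - 6) * (-5 + 8 * y3) +
    (4 * h ^ 2 - 24 * h + 44) * (1 + 2 * y4)) +
    k * (-3 + 2 * n + 3 * y1 - 3 * y2 + 2 * y3 - 3 * y4), ?_⟩
  linear_combination 3 * (1 - 10 * n + 16 * y2) * e2 + (-5 + 8 * y3) * e3 + (1 + 2 * y4) * e4 -
    (-3 + 2 * n + 3 * y1 - 3 * y2 + 2 * y3 - 3 * y4) * hw'

theorem _root_.eulerE_add_modEq (q k n : ℕ) (c : ℤ) (hq : 4 ≤ q) (hk : 0 < k)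
    (hc : (64 : ℤ) ∣ -2 + 40 * n - 24 * n ^ 2 - 6 * c) :
    eulerE (2 ^ (q + 1) * k + 2 * n) ≡ eulerE (2 * n) + c * 2 ^ (q + 1) * k
      [ZMOD 2 ^ (q + 1 + 5)] := by
  obtain ⟨y, hy⟩ := two_pow_dvd_three_mul_eulerE_sub q k n hq hk
  obtain ⟨x, hx⟩ := hc
  rw [show 2 ^ (q + 1) * k + 2 * n = 2 * (n + 2 ^ q * k) by ring]
  apply Int.ModEq.symm
  rw [Int.modEq_iff_dvd, show q + 1 + 5 = q + 6 by ring]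
  have hco : IsCoprime ((2 : ℤ) ^ (q + 6)) 3 :=
    IsCoprime.pow_left ⟨-1, 1, by norm_num⟩
  refine hco.dvd_of_dvd_mul_left ⟨y + k * x, ?_⟩
  rw [pow_add] at hy ⊢
  rw [pow_add]
  linear_combination hy + 2 ^ q * k * hx

end eulerFunctional

theorem stern_ext_mod_two_pow_add_five (b k m : ℕ) (hb : Even b) (hk : 0 < k) (hm : 5 ≤ m) :
    ((b % 16 = 0 ∨ b % 16 = 14) →
      eulerE (2 ^ m * k + b) ≡ eulerE b - 11 * 2 ^ m * k [ZMOD 2 ^ (m + 5)]) ∧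
    ((b % 16 = 2 ∨ b % 16 = 12) →
      eulerE (2 ^ m * k + b) ≡ eulerE b + 13 * 2 ^ m * k [ZMOD 2 ^ (m + 5)]) ∧
    ((b % 16 = 4 ∨ b % 16 = 10) →
      eulerE (2 ^ m * k + b) ≡ eulerE b - 3 * 2 ^ m * k [ZMOD 2 ^ (m + 5)]) ∧
    ((b % 16 = 6 ∨ b % 16 = 8) →
      eulerE (2 ^ m * k + b) ≡ eulerE b + 5 * 2 ^ m * k [ZMOD 2 ^ (m + 5)]) := by
  obtain ⟨n, rfl⟩ := hb.two_dvd
  obtain ⟨q, rfl⟩ : ∃ q, m = q + 1 := ⟨m - 1, by omega⟩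
  have key (c : ℤ) (r : ℕ) (hr : n % 8 = r)
      (hc : (64 : ℤ) ∣ -2 + 40 * r - 24 * r ^ 2 - 6 * c) :
      eulerE (2 ^ (q + 1) * k + 2 * n) ≡ eulerE (2 * n) + c * 2 ^ (q + 1) * k
        [ZMOD 2 ^ (q + 1 + 5)] := by
    refine eulerE_add_modEq q k n c (by omega) hk ?_
    obtain ⟨x, hx⟩ := hc
    obtain ⟨N, rfl⟩ : ∃ N, n = 8 * N + r := ⟨n / 8, by omega⟩
    refine ⟨x + 5 * N - 24 * N ^ 2 - 6 * N * r, ?_⟩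
    push_cast
    linear_combination hx
  refine ⟨fun h => ?_, fun h => ?_, fun h => ?_, fun h => ?_⟩
  · rw [sub_eq_add_neg, ← neg_mul, ← neg_mul]
    rcases h with h | h
    · exact key (-11) 0 (by omega) (by norm_num)
    · exact key (-11) 7 (by omega) (by norm_num)
  · rcases h with h | h
    · exact key 13 1 (by omega) (by norm_num)
    · exact key 13 6 (by omega) (by norm_num)
  · rw [sub_eq_add_neg, ← neg_mul, ← neg_mul]
    rcases h with h | h
    · exact key (-3) 2 (by omega) (by norm_num)
    · exact key (-3) 5 (by omega) (by norm_num)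
  · rcases h with h | h
    · exact key 5 3 (by omega) (by norm_num)
    · exact key 5 4 (by omega) (by norm_num)
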